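/- arXiv:math/0305123 — 2 statements merged into one kernel-verified Lean document; each statement's English description precedes it below -/
import Mathlib

section
/- For every real number q with 0 < q < 1 and all integers r ≥ 1, m ≥ 0, K ≥ 0, the sum over all chains of integers 0 ≤ k_r ≤ k_{r-1} ≤ … ≤ k_1 ≤ K of (q^{2+2k_r};q²)_m · q^{2(k_1+…+k_r)} equals (q²;q²)_m · (q^{2K+2};q²)_{r+m} / (q²;q²)_{r+m}. (This identity computes the eigenvalues of Toeplitz operators with radial finite symbols on the q-weighted Bergman space.) -/
/-- The q²-shifted factorial `(a; q²)_m = ∏_{j=0}^{m-1} (1 − a q^{2j})`. -/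
noncomputable def qpochR (q a : ℝ) (m : ℕ) : ℝ :=
  ∏ j ∈ Finset.range m, (1 - a * q ^ (2 * j))

theorem qpochR_succ (q a : ℝ) (n : ℕ) :
    qpochR q a (n + 1) = qpochR q a n * (1 - a * q ^ (2 * n)) :=
  Finset.prod_range_succ _ _

theorem qpochR_succ' (q a : ℝ) (n : ℕ) :
    qpochR q a (n + 1) = (1 - a) * qpochR q (a * q ^ 2) n := by
  rw [qpochR, Finset.prod_range_succ', mul_comm, qpochR]
  congr 1
  · simp
  · refine Finset.prod_congr rfl fun j _ => ?_
    ring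

theorem qpochR_sq_pos {q : ℝ} (hq0 : 0 < q) (hq1 : q < 1) (n : ℕ) : 0 < qpochR q (q ^ 2) n := by
  refine Finset.prod_pos fun j _ => ?_
  rw [← pow_add, sub_pos]
  exact pow_lt_one₀ hq0.le hq1 (by omega)

/-- The telescoping sum of `q²`-shifted factorials. -/
theorem sum_range_pow_mul_qpochR (q : ℝ) (n N : ℕ) :
    (∑ k ∈ Finset.range N, q ^ (2 * k) * qpochR q (q ^ (2 * k + 2)) n) * (1 - q ^ (2 * n + 2)) =
      qpochR q (q ^ (2 * N)) (n + 1) := by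
  induction N with
  | zero => simp [qpochR_succ']
  | succ N ih =>
    rw [Finset.sum_range_succ, add_mul, ih, qpochR_succ', ← pow_add, Nat.mul_succ, qpochR_succ]
    ring

/-- The weakly decreasing sequences of length `r` of natural numbers at most `K`. -/
def boundedChains (r K : ℕ) : Finset (Fin r → ℕ) :=
  (Fintype.piFinset fun _ => Finset.range (K + 1)).filter
    fun l => ∀ i j : Fin r, i ≤ j → l j ≤ l i

theorem mem_boundedChains {r K : ℕ} {l : Fin r → ℕ} :
    l ∈ boundedChains r K ↔ (∀ i, l i ≤ K) ∧ ∀ i j : Fin r, i ≤ j → l j ≤ l i := by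
  simp [boundedChains]

theorem cons_mem_boundedChains {r K k : ℕ} {l : Fin r → ℕ} :
    (Fin.cons k l : Fin (r + 1) → ℕ) ∈ boundedChains (r + 1) K ↔
      k ≤ K ∧ l ∈ boundedChains r k := by
  simp only [mem_boundedChains, Fin.forall_fin_succ, Fin.cons_zero, Fin.cons_succ,
    Fin.succ_le_succ_iff]
  constructor
  · rintro ⟨⟨h, -⟩, ⟨-, h'⟩, h''⟩
    exact ⟨h, fun i => h' i (Fin.zero_le _), fun i j hij => (h'' i).2 j hij⟩
  · rintro ⟨h, h', h''⟩
    exact ⟨⟨h, fun i => (h' i).trans h⟩, ⟨fun _ => le_rfl, fun i _ => h' i⟩,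
      fun i => ⟨fun hi => absurd hi (Fin.succ_pos i).not_ge, h'' i⟩⟩

theorem sum_boundedChains_succ {M : Type*} [AddCommMonoid M] (r K : ℕ)
    (f : (Fin (r + 1) → ℕ) → M) :
    ∑ l ∈ boundedChains (r + 1) K, f l =
      ∑ k ∈ Finset.range (K + 1), ∑ l ∈ boundedChains r k, f (Fin.cons k l) := by
  rw [Finset.sum_sigma']
  refine Finset.sum_bij' (fun l _ => (⟨l 0, Fin.tail l⟩ : (_ : ℕ) × (Fin r → ℕ)))
    (fun x _ => Fin.cons x.1 x.2) ?_ ?_ ?_ ?_ ?_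
  · intro l hl
    rw [← Fin.cons_self_tail l, cons_mem_boundedChains] at hl
    simpa [Nat.lt_succ_iff] using hl
  · rintro ⟨k, l⟩ hx
    rw [cons_mem_boundedChains]
    simpa [Nat.lt_succ_iff] using hx
  · intro l _
    exact Fin.cons_self_tail l
  · rintro ⟨k, l⟩ _
    simp
  · intro l _
    rw [Fin.cons_self_tail]

/-- The chain sum in closed form; for the empty chain the last entry is read as `K`. -/
theorem sum_boundedChains_qpochR {q : ℝ} (hq0 : 0 < q) (hq1 : q < 1) (m r K : ℕ) :
    ∑ l ∈ boundedChains r K,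
      qpochR q (q ^ (2 + 2 * (Fin.cons K l : Fin (r + 1) → ℕ) (Fin.last r))) m *
        q ^ (2 * ∑ i, l i) =
    qpochR q (q ^ 2) m * qpochR q (q ^ (2 * K + 2)) (r + m) / qpochR q (q ^ 2) (r + m) := by
  induction r generalizing K with
  | zero =>
    have h : boundedChains 0 K = Finset.univ :=
      Finset.eq_univ_of_forall fun l => by simp [mem_boundedChains]
    have hm := (qpochR_sq_pos hq0 hq1 m).ne'
    rw [h, Fintype.sum_unique]
    simp [Fin.last, hm, add_comm]
  | succ r ih =>
    have hstep (k : ℕ) : ∑ l ∈ boundedChains r k,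
        qpochR q (q ^ (2 + 2 * (Fin.cons K (Fin.cons k l : Fin (r + 1) → ℕ) :
          Fin (r + 2) → ℕ) (Fin.last (r + 1)))) m *
          q ^ (2 * ∑ i, (Fin.cons k l : Fin (r + 1) → ℕ) i) =
        qpochR q (q ^ 2) m / qpochR q (q ^ 2) (r + m) *
          (q ^ (2 * k) * qpochR q (q ^ (2 * k + 2)) (r + m)) := by
      rw [mul_left_comm, div_mul_eq_mul_div, ← ih k, Finset.mul_sum]
      refine Finset.sum_congr rfl fun l _ => ?_
      rw [← Fin.succ_last, Fin.cons_succ, Fin.sum_cons]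
      ring
    have hn := (qpochR_sq_pos hq0 hq1 (r + m)).ne'
    have hc : 1 - q ^ (2 * (r + m) + 2) ≠ 0 :=
      (sub_pos.2 (pow_lt_one₀ hq0.le hq1 (by omega))).ne'
    rw [sum_boundedChains_succ, Finset.sum_congr rfl fun k _ => hstep k, ← Finset.mul_sum,
      Nat.add_right_comm r 1 m, ← Nat.mul_succ 2 K, ← sum_range_pow_mul_qpochR, qpochR_succ,
      ← pow_add, add_comm 2 (2 * (r + m))]
    field_simp

/-- For `0 < q < 1`, `r ≥ 1`, `m, K ≥ 0`, the sum over all chains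
`0 ≤ k_r ≤ … ≤ k_1 ≤ K` of `(q^{2+2k_r};q²)_m · q^{2(k_1+…+k_r)}` equals
`(q²;q²)_m (q^{2K+2};q²)_{r+m} / (q²;q²)_{r+m}`. -/
theorem statement1 (q : ℝ) (hq0 : 0 < q) (hq1 : q < 1) (r : ℕ) (hr : 1 ≤ r) (m K : ℕ) :
    (∑ l ∈ Finset.univ.filter
        (fun l : Fin r → (Finset.Icc 0 K) =>
          ∀ i j : Fin r, i ≤ j → ((l j : ℕ) ≤ (l i : ℕ))),
      qpochR q (q ^ (2 + 2 * ((l ⟨r - 1, by omega⟩ : ℕ)))) m * q ^ (2 * ∑ i, ((l i : ℕ)))) =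
    qpochR q (q ^ 2) m * qpochR q (q ^ (2 * K + 2)) (r + m) / qpochR q (q ^ 2) (r + m) := by
  obtain ⟨r, rfl⟩ := Nat.exists_eq_add_of_le' hr
  rw [← sum_boundedChains_qpochR hq0 hq1]
  refine Finset.sum_bij (fun l _ i => (l i : ℕ)) ?_ ?_ ?_ ?_
  · intro l hl
    exact mem_boundedChains.2 ⟨fun i => (Finset.mem_Icc.1 (l i).2).2, (Finset.mem_filter.1 hl).2⟩
  · intro l _ l' _ h
    exact funext fun i => Subtype.ext (congrFun h i)
  · intro l hl
    obtain ⟨hK, hl⟩ := mem_boundedChains.1 hl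
    exact ⟨fun i => ⟨l i, Finset.mem_Icc.2 ⟨Nat.zero_le _, hK i⟩⟩,
      Finset.mem_filter.2 ⟨Finset.mem_univ _, hl⟩, rfl⟩
  · intro l _
    rfl
end

section
/- For every real q with 0 < q < 1, every integer n ≥ 1, and every finitely supported function f : ℤ_{≥0} → ℂ: (q²;q²)_n · Σ_{k_1 ≥ k_2 ≥ … ≥ k_n ≥ 0} f(k_1) q^{−2nk_1} q^{2(k_2+…+k_n)} = (1 − q^{2n}) Σ_{k=0}^{∞} f(k) q^{−2nk} (q^{2k+2};q²)_{n−1}. (This expresses the restriction of the invariant integral on the quantum ball to radial functions as a one-dimensional Jackson-type sum.) -/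
/-- The q²-shifted factorial `(a; q²)_m = ∏_{j=0}^{m-1} (1 − a q^{2j})`. -/
noncomputable def qpochC (q : ℝ) (a : ℂ) (m : ℕ) : ℂ :=
  ∏ j ∈ Finset.range m, (1 - a * (q : ℂ) ^ (2 * j))

/-- The weakly decreasing `m`-tuples of natural numbers that are at most `K`. -/
noncomputable def antitoneTuples (m K : ℕ) : Finset (Fin m → ℕ) :=
  open Classical in {k ∈ Fintype.piFinset fun _ : Fin m => Finset.range (K + 1) | Antitone k}

lemma mem_antitoneTuples {m K : ℕ} {k : Fin m → ℕ} :
    k ∈ antitoneTuples m K ↔ (∀ i, k i ≤ K) ∧ Antitone k := by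
  simp [antitoneTuples]

lemma cons_mem_antitoneTuples {m K j : ℕ} {k : Fin m → ℕ} :
    (Fin.cons j k : Fin (m + 1) → ℕ) ∈ antitoneTuples (m + 1) K ↔
      j ≤ K ∧ k ∈ antitoneTuples m j := by
  simp only [mem_antitoneTuples, Fin.forall_fin_succ, Fin.cons_zero, Fin.cons_succ]
  constructor
  · rintro ⟨⟨hj, -⟩, h⟩
    exact ⟨hj, fun i => by simpa using h (Fin.zero_le i.succ),
      fun a b hab => by simpa using h (Fin.succ_le_succ_iff.2 hab)⟩
  · rintro ⟨hj, hk, h⟩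
    refine ⟨⟨hj, fun i => (hk i).trans hj⟩, fun a b hab => ?_⟩
    induction a using Fin.cases with
    | zero => induction b using Fin.cases with
      | zero => simp
      | succ b => simpa using hk b
    | succ a => induction b using Fin.cases with
      | zero => simp at hab
      | succ b => simpa using h (Fin.succ_le_succ_iff.1 hab)

lemma sum_antitoneTuples_succ {M : Type*} [AddCommMonoid M] (m K : ℕ)
    (F : (Fin (m + 1) → ℕ) → M) :
    ∑ k ∈ antitoneTuples (m + 1) K, F k =
      ∑ j ∈ Finset.range (K + 1), ∑ k ∈ antitoneTuples m j, F (Fin.cons j k) := by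
  rw [Finset.sum_sigma']
  refine Finset.sum_bij' (fun k _ => ⟨k 0, Fin.tail k⟩) (fun p _ => Fin.cons p.1 p.2)
    (fun k hk => ?_) (fun p hp => ?_) (fun k _ => Fin.cons_self_tail k) (fun p _ => by simp)
    (fun k _ => by simp only [Fin.cons_self_tail])
  · rw [← Fin.cons_self_tail k, cons_mem_antitoneTuples] at hk
    simpa [Nat.lt_succ_iff] using hk
  · simpa [cons_mem_antitoneTuples, Nat.lt_succ_iff] using hp

lemma qpochC_succ (q : ℝ) (a : ℂ) (m : ℕ) :
    qpochC q a (m + 1) = qpochC q a m * (1 - a * (q : ℂ) ^ (2 * m)) :=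
  Finset.prod_range_succ _ _

lemma qpochC_succ' (q : ℝ) (a : ℂ) (m : ℕ) :
    qpochC q a (m + 1) = (1 - a) * qpochC q (a * (q : ℂ) ^ 2) m := by
  rw [qpochC, Finset.prod_range_succ', mul_comm]
  congr 1
  · simp
  · exact Finset.prod_congr rfl fun j _ => by ring

lemma qpochC_one_succ (q : ℝ) (m : ℕ) : qpochC q 1 (m + 1) = 0 := by
  simp [qpochC_succ']

lemma sum_pow_mul_qpochC (q : ℝ) (m K : ℕ) :
    (1 - (q : ℂ) ^ (2 * (m + 1))) *
        ∑ j ∈ Finset.range K, (q : ℂ) ^ (2 * j) * qpochC q ((q : ℂ) ^ (2 * j + 2)) m =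
      qpochC q ((q : ℂ) ^ (2 * K)) (m + 1) := by
  induction K with
  | zero => simp [qpochC_one_succ]
  | succ K ih =>
    rw [Finset.sum_range_succ, mul_add, ih, qpochC_succ', qpochC_succ]
    ring_nf

/-- The generating function of partitions into at most `m` parts, each at most `K`, in the
variable `q²`, is a Gaussian binomial coefficient. -/
lemma qpochC_mul_sum_antitoneTuples (q : ℝ) (m K : ℕ) :
    qpochC q ((q : ℂ) ^ 2) m * ∑ k ∈ antitoneTuples m K, (q : ℂ) ^ (2 * ∑ i, k i) =
      qpochC q ((q : ℂ) ^ (2 * K + 2)) m := by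
  induction m generalizing K with
  | zero =>
    have h : antitoneTuples 0 K = {default} := by
      ext k
      simp [mem_antitoneTuples, Subsingleton.elim k default, Subsingleton.antitone]
    simp [h, qpochC]
  | succ m ih =>
    rw [sum_antitoneTuples_succ, qpochC_succ, show 2 * K + 2 = 2 * (K + 1) by ring,
      ← sum_pow_mul_qpochC]
    simp_rw [← ih, Fin.sum_cons, mul_add, pow_add, Finset.mul_sum]
    refine Finset.sum_congr rfl fun j _ => Finset.sum_congr rfl fun k _ => ?_
    ring

/-- The restriction of the invariant integral on the quantum ball to radial functions:
for finitely supported `f : ℤ_{≥0} → ℂ`,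
`(q²;q²)_n Σ_{k_1≥…≥k_n≥0} f(k_1) q^{−2nk_1} q^{2(k_2+…+k_n)}
  = (1 − q^{2n}) Σ_{k≥0} f(k) q^{−2nk} (q^{2k+2};q²)_{n−1}`. -/
theorem statement3 (q : ℝ) (hq0 : 0 < q) (hq1 : q < 1) (n : ℕ) (hn : 1 ≤ n)
    (f : ℕ → ℂ) (hf : (Function.support f).Finite) :
    qpochC q ((q : ℂ) ^ 2) n *
      ∑' k : {k : Fin n → ℕ // ∀ i j : Fin n, i ≤ j → k j ≤ k i},
        f (k.1 ⟨0, by omega⟩) * ((q : ℂ) ^ (2 * n * k.1 ⟨0, by omega⟩))⁻¹ *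
          (q : ℂ) ^ (2 * ((∑ j : Fin n, k.1 j) - k.1 ⟨0, by omega⟩)) =
    (1 - (q : ℂ) ^ (2 * n)) *
      ∑' k : ℕ, f k * ((q : ℂ) ^ (2 * n * k))⁻¹ * qpochC q ((q : ℂ) ^ (2 * k + 2)) (n - 1) := by
  obtain ⟨m, rfl⟩ : ∃ m, n = m + 1 := ⟨n - 1, by omega⟩
  obtain ⟨N, hN⟩ : ∃ N, ∀ k, f k ≠ 0 → k ≤ N :=
    hf.bddAbove.imp fun N h k hk => h hk
  set g : (Fin (m + 1) → ℕ) → ℂ := fun k =>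
    f (k 0) * ((q : ℂ) ^ (2 * (m + 1) * k 0))⁻¹ * (q : ℂ) ^ (2 * ((∑ j, k j) - k 0)) with hg
  have hL : ∑' k : {k : Fin (m + 1) → ℕ // ∀ i j, i ≤ j → k j ≤ k i}, g k.1 =
      ∑ k ∈ antitoneTuples (m + 1) N, g k := by
    refine (tsum_subtype {k : Fin (m + 1) → ℕ | ∀ i j, i ≤ j → k j ≤ k i} g).trans ?_
    rw [tsum_eq_sum (s := antitoneTuples (m + 1) N)]
    · refine Finset.sum_congr rfl fun k hk => ?_
      rw [Set.indicator_of_mem]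
      exact fun i j hij => (mem_antitoneTuples.1 hk).2 hij
    · intro k hk
      rw [Set.indicator_apply_eq_zero]
      intro hk'
      by_contra h
      refine hk (mem_antitoneTuples.2 ⟨fun i => (hk' 0 i (Fin.zero_le i)).trans (hN _ ?_),
        fun i j hij => hk' i j hij⟩)
      intro h0
      exact h (by simp [hg, h0])
  have hR : ∀ k ∉ Finset.range (N + 1), f k * ((q : ℂ) ^ (2 * (m + 1) * k))⁻¹ *
      qpochC q ((q : ℂ) ^ (2 * k + 2)) (m + 1 - 1) = 0 := by
    intro k hk
    have h0 : f k = 0 := by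
      by_contra h
      exact hk (Finset.mem_range.2 (Nat.lt_succ_of_le (hN k h)))
    simp [h0]
  refine (congrArg _ hL).trans ?_
  rw [tsum_eq_sum hR, sum_antitoneTuples_succ, qpochC_succ, Nat.add_sub_cancel]
  simp_rw [← qpochC_mul_sum_antitoneTuples, hg, Fin.sum_cons, Fin.cons_zero,
    Nat.add_sub_cancel_left, Finset.mul_sum]
  refine Finset.sum_congr rfl fun j _ => Finset.sum_congr rfl fun k _ => ?_
  ring
end
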